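/- Let (Z,ρ₀) be an antipodal space. Then M(Z) is geodesically complete. More precisely, let γ₀ : [a,b] → M(Z) be a geodesic segment (an isometric embedding of [a,b]) with endpoints ρ₀' = γ₀(a), ρ₁ = γ₀(b), let ξ₀ ∈ Z be a point where dρ₁/dρ₀' attains its maximum, and let η₀ ∈ Z satisfy ρ₀'(ξ₀,η₀) = 1. Then there exists a bi-infinite geodesic κ : ℝ → M(Z) (an isometric embedding of ℝ) extending γ₀ such that for all t > a the function dκ(t)/dρ₀' attains its maximum at ξ₀, and for all t < a it attains its maximum at η₀. -/

import Mathlib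

open Filter Topology
open scoped Classical

variable {Z : Type*}

/-- `Z` has at least four points. -/
def HasFourPoints (Z : Type*) : Prop :=
  ∃ a b c d : Z, a ≠ b ∧ a ≠ c ∧ a ≠ d ∧ b ≠ c ∧ b ≠ d ∧ c ≠ d

/-- A separating function on `Z`: continuous, symmetric, and positive. -/
structure IsSeparating [TopologicalSpace Z] (ρ : Z → Z → ℝ) : Prop where
  continuous : Continuous fun p : Z × Z => ρ p.1 p.2
  symm : ∀ ξ η, ρ ξ η = ρ η ξ
  nonneg : ∀ ξ η, 0 ≤ ρ ξ η
  eq_zero_iff : ∀ ξ η, ρ ξ η = 0 ↔ ξ = η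

/-- The cross-ratio of a quadruple of points with respect to `ρ`. -/
noncomputable def crossRatio (ρ : Z → Z → ℝ) (ξ ξ' η η' : Z) : ℝ :=
  ρ ξ η * ρ ξ' η' / (ρ ξ η' * ρ ξ' η)

/-- Two functions are Moebius equivalent if their cross-ratios agree on all quadruples
of pairwise distinct points. -/
def MoebiusEquiv (ρ₁ ρ₂ : Z → Z → ℝ) : Prop :=
  ∀ ξ ξ' η η' : Z, ξ ≠ ξ' → ξ ≠ η → ξ ≠ η' → ξ' ≠ η → ξ' ≠ η' → η ≠ η' →
    crossRatio ρ₁ ξ ξ' η η' = crossRatio ρ₂ ξ ξ' η η'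

/-- An antipodal function on `Z`: a separating function with values in `[0,1]` such that
every point has an antipode. -/
structure IsAntipodal [TopologicalSpace Z] (ρ : Z → Z → ℝ) : Prop where
  toIsSeparating : IsSeparating ρ
  le_one : ∀ ξ η, ρ ξ η ≤ 1
  antipode : ∀ ξ, ∃ η, ρ ξ η = 1

/-- The Moebius space `M(Z, ρ₀)`: antipodal functions Moebius equivalent to `ρ₀`. -/
def MoebiusSpace [TopologicalSpace Z] (ρ₀ : Z → Z → ℝ) : Set (Z → Z → ℝ) :=
  {ρ | IsAntipodal ρ ∧ MoebiusEquiv ρ₀ ρ}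

/-- The derivative `dρ₂/dρ₁`: the (unique, when it exists) positive continuous function
satisfying the geometric mean value theorem
`ρ₂(ξ,η)² = f(ξ) f(η) ρ₁(ξ,η)²`. -/
noncomputable def mDeriv [TopologicalSpace Z] (ρ₁ ρ₂ : Z → Z → ℝ) : Z → ℝ :=
  if h : ∃ f : Z → ℝ, Continuous f ∧ (∀ ξ, 0 < f ξ) ∧
      ∀ ξ η, ρ₂ ξ η ^ 2 = f ξ * f η * ρ₁ ξ η ^ 2
  then h.choose else fun _ => 1

/-- The metric `d_M(ρ₁, ρ₂) = ‖log (dρ₂/dρ₁)‖_∞` on the Moebius space. -/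
noncomputable def dM [TopologicalSpace Z] (ρ₁ ρ₂ : Z → Z → ℝ) : ℝ :=
  ⨆ ξ : Z, |Real.log (mDeriv ρ₁ ρ₂ ξ)|

/-- The discrepancy function `D_{ρ₁}(τ)(ξ) = max_{η ≠ ξ} (τ(ξ) + τ(η) + log ρ₁(ξ,η)²)`. -/
noncomputable def discrepancy [TopologicalSpace Z] (ρ₁ : Z → Z → ℝ) (τ : C(Z, ℝ))
    (ξ : Z) : ℝ :=
  ⨆ η : {η : Z // η ≠ ξ}, (τ ξ + τ η.1 + Real.log (ρ₁ ξ η.1 ^ 2))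

/-- `E_{ρ₁}(τ)(ξ,η) = e^{τ(ξ)/2} e^{τ(η)/2} ρ₁(ξ,η)`. -/
noncomputable def eMap [TopologicalSpace Z] (ρ₁ : Z → Z → ℝ) (τ : C(Z, ℝ)) :
    Z → Z → ℝ :=
  fun ξ η => Real.exp (τ ξ / 2) * Real.exp (τ η / 2) * ρ₁ ξ η

/-- A solution of the `ρ₁`-antipodal flow `dτ_t/dt = -D_{ρ₁}(τ_t)` on `[0, ∞)`. -/
def IsAntipodalFlowSol [TopologicalSpace Z] [CompactSpace Z]
    (ρ₁ : Z → Z → ℝ) (τ : ℝ → C(Z, ℝ)) : Prop :=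
  ∀ t ∈ Set.Ici (0 : ℝ), ∃ τ' : C(Z, ℝ),
    (∀ ξ, τ' ξ = -discrepancy ρ₁ (τ t) ξ) ∧
    HasDerivWithinAt τ τ' (Set.Ici (0 : ℝ)) t

/-- The antipodalization map `P_∞(τ₀, ρ₁) = E_{ρ₁}(τ_∞)`, where `τ_∞` is the limit as
`t → ∞` of the solution of the `ρ₁`-antipodal flow starting at `τ₀`. -/
noncomputable def antipodalization [TopologicalSpace Z] [CompactSpace Z]
    (ρ₁ : Z → Z → ℝ) (τ₀ : C(Z, ℝ)) : Z → Z → ℝ :=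
  if h : ∃ p : (ℝ → C(Z, ℝ)) × C(Z, ℝ), p.1 0 = τ₀ ∧ IsAntipodalFlowSol ρ₁ p.1 ∧
      Filter.Tendsto p.1 Filter.atTop (𝓝 p.2)
  then eMap ρ₁ h.choose.2 else ρ₁

namespace MoebiusGeodesic

/-! ### Extremal functions of a nonpositive kernel -/

section Extremal

/-- The conjugate `f*(x) = sup_{y ≠ x} (δ(x,y) - f(y))` of `f` with respect to the kernel `δ`. -/
noncomputable def conjugate (δ : Z → Z → ℝ) (f : Z → ℝ) (x : Z) : ℝ :=
  ⨆ y : {y : Z // y ≠ x}, (δ x y.1 - f y.1)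

/-- The average of a function and its conjugate. -/
noncomputable def average (δ : Z → Z → ℝ) (f : Z → ℝ) (x : Z) : ℝ :=
  (f x + conjugate δ f x) / 2

/-- The infimum of the iterated averages of `f`. -/
noncomputable def extremalHull (δ : Z → Z → ℝ) (f : Z → ℝ) (x : Z) : ℝ :=
  ⨅ n : ℕ, (average δ)^[n] f x

/-- A symmetric kernel, nonpositive off the diagonal, vanishing at some `y ≠ x` for each `x`. -/
structure IsKernel (δ : Z → Z → ℝ) : Prop where
  symm : ∀ x y, δ x y = δ y x
  nonpos : ∀ x y, δ x y ≤ 0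
  exists_eq_zero : ∀ x, ∃ y, y ≠ x ∧ δ x y = 0

/-- Functions with values in `[-M, M]` that dominate their conjugate. -/
structure IsAdmissible (δ : Z → Z → ℝ) (M : ℝ) (f : Z → ℝ) : Prop where
  lower : ∀ x, -M ≤ f x
  upper : ∀ x, f x ≤ M
  conjugate_le : ∀ x, conjugate δ f x ≤ f x

variable {δ : Z → Z → ℝ} {f g : Z → ℝ} {M N c : ℝ}

theorem le_conjugate (hδ : IsKernel δ) (hf : ∀ x, -M ≤ f x) {x y : Z} (hxy : y ≠ x) :
    δ x y - f y ≤ conjugate δ f x := by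
  refine le_ciSup (f := fun y : {y : Z // y ≠ x} => δ x y.1 - f y.1) ⟨M, ?_⟩ ⟨y, hxy⟩
  rintro _ ⟨z, rfl⟩
  have := hδ.nonpos x z.1
  have := hf z.1
  dsimp only
  linarith

theorem conjugate_le_of_forall (hδ : IsKernel δ) {x : Z}
    (h : ∀ y, y ≠ x → δ x y - f y ≤ c) : conjugate δ f x ≤ c := by
  obtain ⟨y, hy, -⟩ := hδ.exists_eq_zero x
  have : Nonempty {y : Z // y ≠ x} := ⟨⟨y, hy⟩⟩
  exact ciSup_le fun z => h z.1 z.2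

theorem conjugate_le_conjugate_add (hδ : IsKernel δ) (hf : ∀ x, -M ≤ f x)
    (h : ∀ x, f x ≤ g x + c) (x : Z) : conjugate δ g x ≤ conjugate δ f x + c := by
  refine conjugate_le_of_forall hδ fun y hy => ?_
  have := le_conjugate hδ hf hy
  have := h y
  linarith

theorem neg_le_conjugate (hδ : IsKernel δ) (hl : ∀ x, -M ≤ f x) (hu : ∀ x, f x ≤ N) (x : Z) :
    -N ≤ conjugate δ f x := by
  obtain ⟨y, hy, h0⟩ := hδ.exists_eq_zero x
  have := le_conjugate hδ hl hy
  have := hu y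
  linarith

theorem IsAdmissible.average_le (hf : IsAdmissible δ M f) (x : Z) : average δ f x ≤ f x := by
  have := hf.conjugate_le x
  unfold average
  linarith

theorem IsAdmissible.average (hδ : IsKernel δ) (hf : IsAdmissible δ M f) :
    IsAdmissible δ M (average δ f) where
  lower x := by
    have := hf.lower x
    have := neg_le_conjugate hδ hf.lower hf.upper x
    unfold MoebiusGeodesic.average
    linarith
  upper x := (hf.average_le x).trans (hf.upper x)
  conjugate_le x := by
    refine conjugate_le_of_forall hδ fun y hy => ?_
    have h1 := le_conjugate hδ hf.lower hy
    have h2 := le_conjugate hδ hf.lower hy.symm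
    rw [hδ.symm y x] at h2
    unfold MoebiusGeodesic.average
    linarith

theorem IsAdmissible.iterate (hδ : IsKernel δ) (hf : IsAdmissible δ M f) (n : ℕ) :
    IsAdmissible δ M ((MoebiusGeodesic.average δ)^[n] f) := by
  induction n with
  | zero => exact hf
  | succ n ih =>
    rw [Function.iterate_succ_apply']
    exact ih.average hδ

theorem IsAdmissible.conjugate_le_conjugate_average (hδ : IsKernel δ) (hf : IsAdmissible δ M f)
    (x : Z) : conjugate δ f x ≤ conjugate δ (MoebiusGeodesic.average δ f) x := by
  have := conjugate_le_conjugate_add (c := 0) hδ (hf.average hδ).lower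
    (fun y => by simpa using hf.average_le y) x
  simpa using this

theorem IsAdmissible.iterate_sub_conjugate_le (hδ : IsKernel δ) (hf : IsAdmissible δ M f)
    (n : ℕ) (x : Z) :
    (MoebiusGeodesic.average δ)^[n] f x - conjugate δ ((MoebiusGeodesic.average δ)^[n] f) x
      ≤ 2 * M * (1 / 2) ^ n := by
  induction n with
  | zero =>
    have := hf.upper x
    have := neg_le_conjugate hδ hf.lower hf.upper x
    simp only [Function.iterate_zero, id_eq, pow_zero]
    linarith
  | succ n ih =>
    rw [Function.iterate_succ_apply', pow_succ]
    have := (hf.iterate hδ n).conjugate_le_conjugate_average hδ x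
    have h : MoebiusGeodesic.average δ ((MoebiusGeodesic.average δ)^[n] f) x =
      ((MoebiusGeodesic.average δ)^[n] f x
        + conjugate δ ((MoebiusGeodesic.average δ)^[n] f) x) / 2 := rfl
    linarith

theorem IsAdmissible.extremalHull_le (hδ : IsKernel δ) (hf : IsAdmissible δ M f) (n : ℕ)
    (x : Z) : extremalHull δ f x ≤ (MoebiusGeodesic.average δ)^[n] f x := by
  refine ciInf_le ⟨-M, ?_⟩ n
  rintro _ ⟨k, rfl⟩
  exact (hf.iterate hδ k).lower x

theorem IsAdmissible.neg_le_extremalHull (hδ : IsKernel δ) (hf : IsAdmissible δ M f) (x : Z) :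
    -M ≤ extremalHull δ f x :=
  le_ciInf fun n => (hf.iterate hδ n).lower x

theorem IsAdmissible.conjugate_iterate_le_extremalHull (hδ : IsKernel δ)
    (hf : IsAdmissible δ M f) (n : ℕ) (x : Z) :
    conjugate δ ((MoebiusGeodesic.average δ)^[n] f) x ≤ extremalHull δ f x := by
  have hmono : Monotone fun k => conjugate δ ((MoebiusGeodesic.average δ)^[k] f) x :=
    monotone_nat_of_le_succ fun k => by
      rw [Function.iterate_succ_apply']
      exact (hf.iterate hδ k).conjugate_le_conjugate_average hδ x
  have hanti : Antitone fun k => (MoebiusGeodesic.average δ)^[k] f x :=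
    antitone_nat_of_succ_le fun k => by
      rw [Function.iterate_succ_apply']
      exact (hf.iterate hδ k).average_le x
  refine le_ciInf fun m => ?_
  exact (hmono (le_max_left n m)).trans
    (((hf.iterate hδ (max n m)).conjugate_le x).trans (hanti (le_max_right n m)))

theorem IsAdmissible.conjugate_extremalHull (hδ : IsKernel δ) (hf : IsAdmissible δ M f) (x : Z) :
    conjugate δ (extremalHull δ f) x = extremalHull δ f x := by
  have hlim : Tendsto (fun n : ℕ => 2 * M * (1 / 2 : ℝ) ^ n) atTop (𝓝 0) := by
    simpa using (tendsto_pow_atTop_nhds_zero_of_lt_one (by norm_num : (0 : ℝ) ≤ 1 / 2)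
      (by norm_num)).const_mul (2 * M)
  have key : ∀ n : ℕ, |conjugate δ (extremalHull δ f) x - extremalHull δ f x|
      ≤ 2 * M * (1 / 2 : ℝ) ^ n := by
    intro n
    have h1 := conjugate_le_conjugate_add (c := 0) hδ (hf.neg_le_extremalHull hδ)
      (fun y => by simpa using hf.extremalHull_le hδ n y) x
    have h2 := conjugate_le_conjugate_add (g := extremalHull δ f) (c := 2 * M * (1 / 2 : ℝ) ^ n)
      hδ (hf.iterate hδ n).lower (fun y => by
        have := hf.iterate_sub_conjugate_le hδ n y
        have := hf.conjugate_iterate_le_extremalHull hδ n y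
        linarith) x
    have h3 := hf.extremalHull_le hδ n x
    have h4 := hf.conjugate_iterate_le_extremalHull hδ n x
    have h5 := hf.iterate_sub_conjugate_le hδ n x
    rw [abs_le]
    constructor <;> linarith
  have := ge_of_tendsto' hlim key
  exact sub_eq_zero.1 (abs_eq_zero.1 (le_antisymm this (abs_nonneg _)))

theorem extremalHull_eq_self (h : conjugate δ f = f) : extremalHull δ f = f := by
  have hfix : MoebiusGeodesic.average δ f = f := by
    funext x
    simp [MoebiusGeodesic.average, h]
  funext x
  simp [extremalHull, Function.iterate_fixed hfix]

theorem IsAdmissible.iterate_le_iterate_add (hδ : IsKernel δ) (hf : IsAdmissible δ M f)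
    (hg : IsAdmissible δ N g) (h : ∀ x, f x ≤ g x + c) (h' : ∀ x, g x ≤ f x + c) (n : ℕ) :
    (∀ x, (MoebiusGeodesic.average δ)^[n] f x ≤ (MoebiusGeodesic.average δ)^[n] g x + c) ∧
      ∀ x, (MoebiusGeodesic.average δ)^[n] g x ≤ (MoebiusGeodesic.average δ)^[n] f x + c := by
  induction n with
  | zero => exact ⟨h, h'⟩
  | succ n ih =>
    simp only [Function.iterate_succ_apply']
    have h1 := conjugate_le_conjugate_add hδ (hf.iterate hδ n).lower ih.1
    have h2 := conjugate_le_conjugate_add hδ (hg.iterate hδ n).lower ih.2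
    constructor <;> intro x <;> have h1 := h1 x <;> have h2 := h2 x <;>
      have h3 := ih.1 x <;> have h4 := ih.2 x <;>
      simp only [MoebiusGeodesic.average] at * <;> linarith

theorem IsAdmissible.extremalHull_le_add (hδ : IsKernel δ) (hf : IsAdmissible δ M f)
    (hg : IsAdmissible δ N g) (h : ∀ x, f x ≤ g x + c) (h' : ∀ x, g x ≤ f x + c) (x : Z) :
    extremalHull δ f x ≤ extremalHull δ g x + c := by
  rw [← sub_le_iff_le_add]
  refine le_ciInf fun n => ?_
  have := hf.extremalHull_le hδ n x
  have := (hf.iterate_le_iterate_add hδ hg h h' n).1 x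
  linarith

theorem isAdmissible_spike (hδ : IsKernel δ) (ξ : Z) {t : ℝ} (ht : 0 ≤ t) :
    IsAdmissible δ t (fun x => if x = ξ then -t else t) where
  lower x := by split_ifs <;> linarith
  upper x := by split_ifs <;> linarith
  conjugate_le x := by
    refine conjugate_le_of_forall hδ fun y hy => ?_
    have := hδ.nonpos x y
    by_cases hx : x = ξ
    · have hy' : y ≠ ξ := fun h => hy (h.trans hx.symm)
      simp only [hx, hy', if_true, if_false]
      rw [hx] at this
      linarith
    · simp only [hx, if_false]
      split_ifs <;> linarith

/-- A `1`-Lipschitz ray of extremal functions issuing from `0` that is steepest at `ξ`. -/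
theorem exists_extremal_ray (hδ : IsKernel δ) (ξ : Z) :
    ∃ p : ℝ → Z → ℝ, p 0 = 0 ∧ (∀ t, 0 ≤ t → p t ξ = -t) ∧
      (∀ s t, 0 ≤ s → 0 ≤ t → ∀ x, p s x ≤ p t x + |s - t|) ∧
      (∀ t, 0 ≤ t → ∀ x, -t ≤ p t x) ∧
      ∀ t, 0 ≤ t → conjugate δ (p t) = p t := by
  let F : ℝ → Z → ℝ := fun t x => if x = ξ then -t else t
  have hF : ∀ t, 0 ≤ t → IsAdmissible δ t (F t) := fun t ht => isAdmissible_spike hδ ξ ht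
  have hlip : ∀ s t x, F s x ≤ F t x + |s - t| := by
    intro s t x
    have h1 := le_abs_self (s - t)
    have h2 := neg_abs_le (s - t)
    simp only [F]
    split_ifs <;> linarith
  have hhull : ∀ s t, 0 ≤ s → 0 ≤ t → ∀ x,
      extremalHull δ (F s) x ≤ extremalHull δ (F t) x + |s - t| := fun s t hs ht x =>
    (hF s hs).extremalHull_le_add hδ (hF t ht) (hlip s t)
      (fun x => by rw [abs_sub_comm]; exact hlip t s x) x
  have hF0 : F 0 = 0 := by
    funext x
    simp [F]
  have h0 : extremalHull δ (F 0) = 0 := by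
    rw [hF0]
    refine extremalHull_eq_self (funext fun x => le_antisymm ?_ ?_)
    · refine conjugate_le_of_forall hδ fun y _ => ?_
      simpa using hδ.nonpos x y
    · simpa using neg_le_conjugate (M := 0) (N := 0) (f := 0) hδ (by simp) (by simp) x
  refine ⟨fun t => extremalHull δ (F t), h0, fun t ht => le_antisymm ?_ ?_, hhull,
    fun t ht => (hF t ht).neg_le_extremalHull hδ,
    fun t ht => funext ((hF t ht).conjugate_extremalHull hδ)⟩
  · simpa [F] using (hF t ht).extremalHull_le hδ 0 ξ
  · exact (hF t ht).neg_le_extremalHull hδ ξ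

end Extremal

/-! ### Derivatives of Moebius equivalent functions -/

section Derivative

theorem exists_pair_ne (h4 : HasFourPoints Z) (ξ : Z) : ∃ η ζ : Z, η ≠ ξ ∧ ζ ≠ ξ ∧ η ≠ ζ := by
  obtain ⟨a, b, c, -, hab, hac, -, hbc, -, -⟩ := h4
  by_cases ha : a = ξ
  · exact ⟨b, c, fun h => hab (ha.trans h.symm), fun h => hac (ha.trans h.symm), hbc⟩
  · by_cases hb : b = ξ
    · exact ⟨a, c, ha, fun h => hbc (hb.trans h.symm), hac⟩
    · exact ⟨a, b, ha, hb, hab⟩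

/-- Let `r` be a symmetric positive function with trivial cross-ratios. The triple ratio
`r(ξ,η) r(ξ,ζ) / r(η,ζ)` does not depend on `η` and `ζ`. -/
theorem tripleRatio_eq {r : Z → Z → ℝ} (hsymm : ∀ x y, r x y = r y x)
    (hpos : ∀ x y, x ≠ y → 0 < r x y)
    (hr : ∀ x x' y y', x ≠ x' → x ≠ y → x ≠ y' → x' ≠ y → x' ≠ y' → y ≠ y' →
      r x y * r x' y' = r x y' * r x' y)
    {ξ η ζ η' ζ' : Z} (h1 : η ≠ ξ) (h2 : ζ ≠ ξ) (h3 : η ≠ ζ) (h1' : η' ≠ ξ) (h2' : ζ' ≠ ξ)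
    (h3' : η' ≠ ζ') :
    r ξ η * r ξ ζ / r η ζ = r ξ η' * r ξ ζ' / r η' ζ' := by
  have swap : ∀ η ζ, r ξ η * r ξ ζ / r η ζ = r ξ ζ * r ξ η / r ζ η := fun η ζ => by
    rw [hsymm η ζ, mul_comm]
  have step : ∀ η ζ η', η ≠ ξ → ζ ≠ ξ → η' ≠ ξ → η ≠ ζ → η' ≠ ζ →
      r ξ η * r ξ ζ / r η ζ = r ξ η' * r ξ ζ / r η' ζ := by
    intro η ζ η' a1 a2 a3 a4 a5
    by_cases hη : η = η'
    · rw [hη]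
    have := hr ξ ζ η η' a2.symm a1.symm a3.symm a4.symm a5.symm hη
    rw [div_eq_div_iff (hpos _ _ a4).ne' (hpos _ _ a5).ne', hsymm η' ζ, hsymm η ζ]
    linear_combination r ξ ζ * this
  by_cases h : η' = ζ
  · rw [swap η ζ, ← h, swap η' η, swap η' ζ']
    exact step η η' ζ' h1 h1' h2' (h ▸ h3) h3'.symm
  · rw [step η ζ η' h1 h2 h1' h3 h, swap η' ζ, swap η' ζ']
    exact step ζ η' ζ' h2 h1' h2' (Ne.symm h) h3'.symm

variable [TopologicalSpace Z] {ρ ρ₁ ρ₂ ρ₃ : Z → Z → ℝ} {f g : Z → ℝ}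

theorem IsSeparating.pos (h : IsSeparating ρ) {ξ η : Z} (hne : ξ ≠ η) : 0 < ρ ξ η :=
  lt_of_le_of_ne (h.nonneg ξ η) fun h0 => hne ((h.eq_zero_iff ξ η).1 h0.symm)

/-- `f` is a positive continuous function satisfying the geometric mean value identity. -/
structure IsMDeriv (ρ₁ ρ₂ : Z → Z → ℝ) (f : Z → ℝ) : Prop where
  continuous : Continuous f
  pos : ∀ ξ, 0 < f ξ
  sq_eq : ∀ ξ η, ρ₂ ξ η ^ 2 = f ξ * f η * ρ₁ ξ η ^ 2

theorem IsMDeriv.unique (h4 : HasFourPoints Z) (h₁ : IsSeparating ρ₁) (hf : IsMDeriv ρ₁ ρ₂ f)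
    (hg : IsMDeriv ρ₁ ρ₂ g) : f = g := by
  funext ξ
  obtain ⟨η, ζ, hη, hζ, hηζ⟩ := exists_pair_ne h4 ξ
  have key : ∀ x y, x ≠ y → f x * f y = g x * g y := fun x y hxy =>
    mul_right_cancel₀ (pow_pos (IsSeparating.pos h₁ hxy) 2).ne'
      ((hf.sq_eq x y).symm.trans (hg.sq_eq x y))
  have h1 := key ξ η hη.symm
  have h2 := key ξ ζ hζ.symm
  have h3 := key η ζ hηζ
  have hmul : f ξ ^ 2 * (f η * f ζ) = g ξ ^ 2 * (f η * f ζ) := by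
    calc f ξ ^ 2 * (f η * f ζ) = (f ξ * f η) * (f ξ * f ζ) := by ring
      _ = g ξ ^ 2 * (g η * g ζ) := by rw [h1, h2]; ring
      _ = g ξ ^ 2 * (f η * f ζ) := by rw [h3]
  have hsq := mul_right_cancel₀ (mul_pos (hf.pos η) (hf.pos ζ)).ne' hmul
  exact (pow_left_inj₀ (hf.pos ξ).le (hg.pos ξ).le two_ne_zero).1 hsq

theorem IsMDeriv.mDeriv_eq (h4 : HasFourPoints Z) (h₁ : IsSeparating ρ₁)
    (hf : IsMDeriv ρ₁ ρ₂ f) : mDeriv ρ₁ ρ₂ = f := by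
  have h : ∃ f : Z → ℝ, Continuous f ∧ (∀ ξ, 0 < f ξ) ∧
      ∀ ξ η, ρ₂ ξ η ^ 2 = f ξ * f η * ρ₁ ξ η ^ 2 := ⟨f, hf.continuous, hf.pos, hf.sq_eq⟩
  rw [mDeriv, dif_pos h]
  obtain ⟨h1, h2, h3⟩ := h.choose_spec
  exact IsMDeriv.unique h4 h₁ ⟨h1, h2, h3⟩ hf

theorem ratio_mul_ratio_eq (h₁ : IsSeparating ρ₁) (h₂ : IsSeparating ρ₂)
    (h : MoebiusEquiv ρ₁ ρ₂) {ξ ξ' η η' : Z} (n1 : ξ ≠ ξ') (n2 : ξ ≠ η) (n3 : ξ ≠ η')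
    (n4 : ξ' ≠ η) (n5 : ξ' ≠ η') (n6 : η ≠ η') :
    ρ₂ ξ η / ρ₁ ξ η * (ρ₂ ξ' η' / ρ₁ ξ' η') = ρ₂ ξ η' / ρ₁ ξ η' * (ρ₂ ξ' η / ρ₁ ξ' η) := by
  have hc := h ξ ξ' η η' n1 n2 n3 n4 n5 n6
  have := IsSeparating.pos h₁ n2
  have := IsSeparating.pos h₁ n3
  have := IsSeparating.pos h₁ n4
  have := IsSeparating.pos h₁ n5
  have := IsSeparating.pos h₂ n3
  have := IsSeparating.pos h₂ n4
  unfold crossRatio at hc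
  rw [div_eq_div_iff (by positivity) (by positivity)] at hc
  rw [div_mul_div_comm, div_mul_div_comm, div_eq_div_iff (by positivity) (by positivity)]
  linarith

theorem exists_isMDeriv [T1Space Z] (h4 : HasFourPoints Z) (h₁ : IsSeparating ρ₁)
    (h₂ : IsSeparating ρ₂) (h : MoebiusEquiv ρ₁ ρ₂) : ∃ f, IsMDeriv ρ₁ ρ₂ f := by
  choose η ζ hη hζ hηζ using exists_pair_ne h4
  let r : Z → Z → ℝ := fun x y => ρ₂ x y / ρ₁ x y
  have hsymm : ∀ x y, r x y = r y x := fun x y => by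
    simp only [r]; rw [h₁.symm, h₂.symm]
  have hpos : ∀ x y, x ≠ y → 0 < r x y := fun x y hxy =>
    div_pos (IsSeparating.pos h₂ hxy) (IsSeparating.pos h₁ hxy)
  have hr : ∀ x x' y y', x ≠ x' → x ≠ y → x ≠ y' → x' ≠ y → x' ≠ y' → y ≠ y' →
      r x y * r x' y' = r x y' * r x' y := fun x x' y y' n1 n2 n3 n4 n5 n6 =>
    ratio_mul_ratio_eq h₁ h₂ h n1 n2 n3 n4 n5 n6
  let f : Z → ℝ := fun ξ => r ξ (η ξ) * r ξ (ζ ξ) / r (η ξ) (ζ ξ)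
  have hf : ∀ ξ y z, y ≠ ξ → z ≠ ξ → y ≠ z → f ξ = r ξ y * r ξ z / r y z :=
    fun ξ y z hy hz hyz => tripleRatio_eq hsymm hpos hr (hη ξ) (hζ ξ) (hηζ ξ) hy hz hyz
  refine ⟨f, ⟨continuous_iff_continuousAt.2 fun ξ => ?_, fun ξ => ?_, fun x y => ?_⟩⟩
  · have hr_cont : ∀ y, y ≠ ξ → ContinuousAt (fun x => r x y) ξ := fun y hy =>
      ContinuousAt.div (h₂.continuous.comp (Continuous.prodMk_left y)).continuousAt
        (h₁.continuous.comp (Continuous.prodMk_left y)).continuousAt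
        (IsSeparating.pos h₁ hy.symm).ne'
    have hcont : ContinuousAt (fun x => r x (η ξ) * r x (ζ ξ) / r (η ξ) (ζ ξ)) ξ :=
      ((hr_cont _ (hη ξ)).mul (hr_cont _ (hζ ξ))).div_const _
    refine hcont.congr ?_
    filter_upwards [isOpen_ne.mem_nhds (hη ξ).symm, isOpen_ne.mem_nhds (hζ ξ).symm] with x hx hx'
    exact (hf x _ _ (Ne.symm hx) (Ne.symm hx') (hηζ ξ)).symm
  · exact div_pos (mul_pos (hpos _ _ (hη ξ).symm) (hpos _ _ (hζ ξ).symm)) (hpos _ _ (hηζ ξ))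
  · by_cases hxy : x = y
    · rw [(h₂.eq_zero_iff x y).2 hxy, (h₁.eq_zero_iff x y).2 hxy]
      ring
    obtain ⟨z, hzx, hzy⟩ : ∃ z, z ≠ x ∧ z ≠ y := by
      by_cases hz : η x = y
      · exact ⟨ζ x, hζ x, fun h => hηζ x (hz.trans h.symm)⟩
      · exact ⟨η x, hη x, hz⟩
    rw [hf x y z (Ne.symm hxy) hzx hzy.symm, hf y x z hxy hzy hzx.symm, hsymm y x]
    have e1 := (hpos x z hzx.symm).ne'
    have e2 := (hpos y z hzy.symm).ne'
    have e3 : ρ₂ x y = r x y * ρ₁ x y :=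
      (div_mul_cancel₀ _ (IsSeparating.pos h₁ hxy).ne').symm
    rw [e3]
    field_simp

theorem isMDeriv_mDeriv [T1Space Z] (h4 : HasFourPoints Z) {ρ₀ : Z → Z → ℝ}
    (h₁ : ρ₁ ∈ MoebiusSpace ρ₀) (h₂ : ρ₂ ∈ MoebiusSpace ρ₀) :
    IsMDeriv ρ₁ ρ₂ (mDeriv ρ₁ ρ₂) := by
  obtain ⟨f, hf⟩ := exists_isMDeriv h4 h₁.1.toIsSeparating h₂.1.toIsSeparating
    fun a b c d n1 n2 n3 n4 n5 n6 =>
      (h₁.2 a b c d n1 n2 n3 n4 n5 n6).symm.trans (h₂.2 a b c d n1 n2 n3 n4 n5 n6)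
  rwa [hf.mDeriv_eq h4 h₁.1.toIsSeparating]

/-- The logarithm of the derivative `dρ₂/dρ₁`. -/
noncomputable def logDeriv (ρ₁ ρ₂ : Z → Z → ℝ) (ξ : Z) : ℝ :=
  Real.log (mDeriv ρ₁ ρ₂ ξ)

theorem logDeriv_add_logDeriv [T1Space Z] (h4 : HasFourPoints Z) {ρ₀ : Z → Z → ℝ}
    (h₁ : ρ₁ ∈ MoebiusSpace ρ₀) (h₂ : ρ₂ ∈ MoebiusSpace ρ₀) (h₃ : ρ₃ ∈ MoebiusSpace ρ₀)
    (ξ : Z) : logDeriv ρ₁ ρ₂ ξ + logDeriv ρ₂ ρ₃ ξ = logDeriv ρ₁ ρ₃ ξ := by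
  have d₁₂ := isMDeriv_mDeriv h4 h₁ h₂
  have d₂₃ := isMDeriv_mDeriv h4 h₂ h₃
  have d₁₃ : IsMDeriv ρ₁ ρ₃ (fun ξ => mDeriv ρ₁ ρ₂ ξ * mDeriv ρ₂ ρ₃ ξ) :=
    ⟨d₁₂.continuous.mul d₂₃.continuous, fun ξ => mul_pos (d₁₂.pos ξ) (d₂₃.pos ξ),
      fun x y => by rw [d₂₃.sq_eq, d₁₂.sq_eq]; ring⟩
  simp only [logDeriv]
  rw [d₁₃.mDeriv_eq h4 h₁.1.toIsSeparating, Real.log_mul (d₁₂.pos ξ).ne' (d₂₃.pos ξ).ne']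

theorem abs_logDeriv_le_dM [CompactSpace Z] [T1Space Z] (h4 : HasFourPoints Z)
    {ρ₀ : Z → Z → ℝ} (h₁ : ρ₁ ∈ MoebiusSpace ρ₀) (h₂ : ρ₂ ∈ MoebiusSpace ρ₀) (ξ : Z) :
    |logDeriv ρ₁ ρ₂ ξ| ≤ dM ρ₁ ρ₂ := by
  have d := isMDeriv_mDeriv h4 h₁ h₂
  have hc : Continuous fun ξ => |Real.log (mDeriv ρ₁ ρ₂ ξ)| :=
    (d.continuous.log fun ξ => (d.pos ξ).ne').abs
  exact le_ciSup (f := fun ξ => |Real.log (mDeriv ρ₁ ρ₂ ξ)|) (isCompact_range hc).bddAbove ξ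

theorem logDeriv_add_logDeriv_nonpos [T1Space Z] (h4 : HasFourPoints Z) {ρ₀ : Z → Z → ℝ}
    (h₁ : ρ₁ ∈ MoebiusSpace ρ₀) (h₂ : ρ₂ ∈ MoebiusSpace ρ₀) {ξ η : Z} (h : ρ₁ ξ η = 1) :
    logDeriv ρ₁ ρ₂ ξ + logDeriv ρ₁ ρ₂ η ≤ 0 := by
  have d := isMDeriv_mDeriv h4 h₁ h₂
  have h' := d.sq_eq ξ η
  rw [h, one_pow, mul_one] at h'
  simp only [logDeriv]
  rw [← Real.log_mul (d.pos ξ).ne' (d.pos η).ne', ← h']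
  exact Real.log_nonpos (sq_nonneg _)
    (pow_le_one₀ (h₂.1.toIsSeparating.nonneg _ _) (h₂.1.le_one _ _))

theorem mDeriv_le_of_dM_le [CompactSpace Z] [T1Space Z] (h4 : HasFourPoints Z)
    {ρ₀ : Z → Z → ℝ} (h₁ : ρ₁ ∈ MoebiusSpace ρ₀) (h₂ : ρ₂ ∈ MoebiusSpace ρ₀) {ξ : Z}
    (h : dM ρ₁ ρ₂ ≤ logDeriv ρ₁ ρ₂ ξ) (ζ : Z) : mDeriv ρ₁ ρ₂ ζ ≤ mDeriv ρ₁ ρ₂ ξ := by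
  have d := isMDeriv_mDeriv h4 h₁ h₂
  exact (Real.log_le_log_iff (d.pos ζ) (d.pos ξ)).1
    ((le_abs_self _).trans ((abs_logDeriv_le_dM h4 h₁ h₂ ζ).trans h))

theorem dM_le_logDeriv_of_mDeriv_le [T1Space Z] (h4 : HasFourPoints Z) {ρ₀ : Z → Z → ℝ}
    (h₁ : ρ₁ ∈ MoebiusSpace ρ₀) (h₂ : ρ₂ ∈ MoebiusSpace ρ₀) {ξ : Z}
    (h : ∀ ζ, mDeriv ρ₁ ρ₂ ζ ≤ mDeriv ρ₁ ρ₂ ξ) : dM ρ₁ ρ₂ ≤ logDeriv ρ₁ ρ₂ ξ := by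
  have d := isMDeriv_mDeriv h4 h₁ h₂
  have hle : ∀ ζ, logDeriv ρ₁ ρ₂ ζ ≤ logDeriv ρ₁ ρ₂ ξ := fun ζ =>
    Real.log_le_log (d.pos ζ) (h ζ)
  have : Nonempty Z := ⟨ξ⟩
  refine ciSup_le fun ζ => abs_le.2 ⟨?_, hle ζ⟩
  obtain ⟨ω, hω⟩ := h₂.1.antipode ζ
  have hprod := d.sq_eq ζ ω
  rw [hω, one_pow] at hprod
  have hρ : ρ₁ ζ ω ^ 2 ≤ 1 :=
    pow_le_one₀ (h₁.1.toIsSeparating.nonneg _ _) (h₁.1.le_one _ _)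
  have hone : 1 ≤ mDeriv ρ₁ ρ₂ ζ * mDeriv ρ₁ ρ₂ ω :=
    hprod.le.trans (mul_le_of_le_one_right (mul_pos (d.pos ζ) (d.pos ω)).le hρ)
  have hlog := Real.log_nonneg hone
  rw [Real.log_mul (d.pos ζ).ne' (d.pos ω).ne'] at hlog
  have := hle ω
  simp only [logDeriv] at *
  linarith

end Derivative

/-! ### Geodesic rays -/

section Ray

variable [TopologicalSpace Z] {ρ ρ₀ : Z → Z → ℝ} {p : Z → ℝ} {M : ℝ}

theorem isKernel_log_sq (h : IsAntipodal ρ) : IsKernel fun x y => Real.log (ρ x y ^ 2) where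
  symm x y := by rw [h.toIsSeparating.symm]
  nonpos x y := Real.log_nonpos (sq_nonneg _)
    (pow_le_one₀ (h.toIsSeparating.nonneg _ _) (h.le_one _ _))
  exists_eq_zero x := by
    obtain ⟨y, hy⟩ := h.antipode x
    refine ⟨y, ?_, by simp [hy]⟩
    rintro rfl
    rw [(h.toIsSeparating.eq_zero_iff y y).2 rfl] at hy
    exact zero_ne_one hy

theorem mul_exp_le_exp (h : IsAntipodal ρ) (hl : ∀ x, -M ≤ p x)
    (hp : conjugate (fun x y => Real.log (ρ x y ^ 2)) p = p) (x y : Z) :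
    ρ x y * Real.exp (-p y / 2) ≤ Real.exp (p x / 2) := by
  by_cases hxy : x = y
  · rw [(h.toIsSeparating.eq_zero_iff x y).2 hxy, zero_mul]
    exact (Real.exp_pos _).le
  have hρ := IsSeparating.pos h.toIsSeparating hxy
  have hle := le_conjugate (isKernel_log_sq h) hl (Ne.symm hxy)
  rw [hp, Real.log_pow] at hle
  calc ρ x y * Real.exp (-p y / 2) = Real.exp (Real.log (ρ x y) + -p y / 2) := by
        rw [Real.exp_add, Real.exp_log hρ]
    _ ≤ Real.exp (p x / 2) := Real.exp_le_exp.2 (by push_cast at hle; linarith)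

theorem exp_le_of_forall_mul_exp_le (h : IsAntipodal ρ)
    (hp : conjugate (fun x y => Real.log (ρ x y ^ 2)) p = p) {x : Z} {c : ℝ} (hc : 0 < c)
    (hle : ∀ y, ρ x y * Real.exp (-p y / 2) ≤ c) : Real.exp (p x / 2) ≤ c := by
  rw [← Real.le_log_iff_exp_le hc, div_le_iff₀ two_pos, ← congrFun hp x]
  refine conjugate_le_of_forall (isKernel_log_sq h) fun y hy => ?_
  have hρ := IsSeparating.pos h.toIsSeparating hy.symm
  have := Real.log_le_log (mul_pos hρ (Real.exp_pos _)) (hle y)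
  rw [Real.log_mul hρ.ne' (Real.exp_pos _).ne', Real.log_exp] at this
  rw [Real.log_pow]
  push_cast
  linarith

theorem continuous_of_conjugate_eq [CompactSpace Z] (h : IsAntipodal ρ) (hl : ∀ x, -M ≤ p x)
    (hp : conjugate (fun x y => Real.log (ρ x y ^ 2)) p = p) : Continuous p := by
  let F : C(Z, C(Z, ℝ)) := ContinuousMap.curry ⟨_, h.toIsSeparating.continuous⟩
  have hbound : ∀ x x', Real.exp (p x / 2) ≤
      Real.exp (p x' / 2) + Real.exp (M / 2) * dist (F x) (F x') := by
    intro x x'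
    refine exp_le_of_forall_mul_exp_le h hp (by positivity) fun y => ?_
    have h1 := mul_exp_le_exp h hl hp x' y
    have h2 : ρ x y - ρ x' y ≤ dist (F x) (F x') :=
      (le_abs_self _).trans (ContinuousMap.dist_apply_le_dist (f := F x) (g := F x') y)
    have h3 : Real.exp (-p y / 2) ≤ Real.exp (M / 2) :=
      Real.exp_le_exp.2 (by linarith [hl y])
    have h4 : (ρ x y - ρ x' y) * Real.exp (-p y / 2)
        ≤ dist (F x) (F x') * Real.exp (M / 2) :=
      mul_le_mul h2 h3 (Real.exp_pos _).le dist_nonneg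
    linarith
  have hexp : Continuous fun x => Real.exp (p x / 2) := by
    refine continuous_iff_continuousAt.2 fun x => tendsto_iff_dist_tendsto_zero.2 ?_
    have hlim : Tendsto (fun y => Real.exp (M / 2) * dist (F y) (F x)) (𝓝 x) (𝓝 0) := by
      simpa using (tendsto_iff_dist_tendsto_zero.1 (F.continuous.tendsto x)).const_mul
        (Real.exp (M / 2))
    refine squeeze_zero (fun _ => dist_nonneg) (fun y => ?_) hlim
    have h1 := hbound x y
    have h2 := hbound y x
    rw [dist_comm (F x)] at h1
    rw [Real.dist_eq, abs_le]
    constructor <;> linarith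
  have hlog := (hexp.log fun x => (Real.exp_pos _).ne').const_mul 2
  simpa [mul_div_cancel₀] using hlog

theorem isSeparating_eMap (h : IsSeparating ρ) (τ : C(Z, ℝ)) : IsSeparating (eMap ρ τ) where
  continuous := by
    have := h.continuous
    unfold eMap
    fun_prop
  symm ξ η := by
    simp only [eMap]
    rw [h.symm ξ η]
    ring
  nonneg ξ η := mul_nonneg (by positivity) (h.nonneg ξ η)
  eq_zero_iff ξ η := by
    simp only [eMap, mul_eq_zero, (Real.exp_pos _).ne', false_or]
    exact h.eq_zero_iff ξ η

theorem eMap_le_one (h : IsAntipodal ρ) (τ : C(Z, ℝ)) (hl : ∀ x, -M ≤ -τ x)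
    (hτ : conjugate (fun x y => Real.log (ρ x y ^ 2)) (fun x => -τ x) = fun x => -τ x)
    (ξ η : Z) : eMap ρ τ ξ η ≤ 1 := by
  have := mul_exp_le_exp h hl hτ ξ η
  rw [neg_neg, neg_div, Real.exp_neg] at this
  calc eMap ρ τ ξ η = Real.exp (τ ξ / 2) * (ρ ξ η * Real.exp (τ η / 2)) := by
        simp only [eMap]
        ring
    _ ≤ Real.exp (τ ξ / 2) * (Real.exp (τ ξ / 2))⁻¹ := by gcongr
    _ = 1 := mul_inv_cancel₀ (Real.exp_pos _).ne'

theorem isAntipodal_eMap [CompactSpace Z] (h : IsAntipodal ρ) (τ : C(Z, ℝ))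
    (hl : ∀ x, -M ≤ -τ x)
    (hτ : conjugate (fun x y => Real.log (ρ x y ^ 2)) (fun x => -τ x) = fun x => -τ x) :
    IsAntipodal (eMap ρ τ) where
  toIsSeparating := isSeparating_eMap h.toIsSeparating τ
  le_one := eMap_le_one h τ hl hτ
  antipode ξ := by
    have hsep := isSeparating_eMap h.toIsSeparating τ
    have : Nonempty Z := ⟨ξ⟩
    obtain ⟨η, -, hη⟩ := isCompact_univ.exists_isMaxOn Set.univ_nonempty
      (hsep.continuous.comp (Continuous.prodMk_right ξ)).continuousOn
    have hmax : ∀ ζ, eMap ρ τ ξ ζ ≤ eMap ρ τ ξ η := fun ζ => hη (Set.mem_univ ζ)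
    obtain ⟨ω, hω, -⟩ := (isKernel_log_sq h).exists_eq_zero ξ
    have hpos : 0 < eMap ρ τ ξ η := (IsSeparating.pos hsep hω.symm).trans_le (hmax ω)
    have hle := exp_le_of_forall_mul_exp_le h hτ (x := ξ)
      (c := Real.exp (-τ ξ / 2) * eMap ρ τ ξ η) (by positivity) fun ζ => by
        calc ρ ξ ζ * Real.exp (- -τ ζ / 2)
            = Real.exp (-τ ξ / 2) * eMap ρ τ ξ ζ := by
              simp only [eMap, neg_neg, neg_div, Real.exp_neg]
              field_simp
          _ ≤ _ := by gcongr; exact hmax ζ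
    exact ⟨η, le_antisymm (eMap_le_one h τ hl hτ ξ η)
      ((le_mul_iff_one_le_right (Real.exp_pos _)).1 hle)⟩

theorem crossRatio_eMap (τ : C(Z, ℝ)) (ξ ξ' η η' : Z) :
    crossRatio (eMap ρ τ) ξ ξ' η η' = crossRatio ρ ξ ξ' η η' := by
  have hpos : Real.exp (τ ξ / 2) * Real.exp (τ ξ' / 2) * Real.exp (τ η / 2)
    * Real.exp (τ η' / 2) ≠ 0 := by positivity
  rw [crossRatio, crossRatio, ← mul_div_mul_left (ρ ξ η * ρ ξ' η') _ hpos]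
  simp only [eMap]
  congr 1 <;> ring

theorem isMDeriv_eMap (τ : C(Z, ℝ)) : IsMDeriv ρ (eMap ρ τ) (fun ξ => Real.exp (τ ξ)) where
  continuous := by fun_prop
  pos _ := Real.exp_pos _
  sq_eq ξ η := by
    have hsq : ∀ x, Real.exp (τ x) = Real.exp (τ x / 2) ^ 2 := fun x => by
      rw [← Real.exp_nat_mul]
      congr 1
      push_cast
      ring
    rw [hsq ξ, hsq η, eMap]
    ring

theorem exists_ray [CompactSpace Z] (h4 : HasFourPoints Z) (h : ρ ∈ MoebiusSpace ρ₀) (ξ : Z) :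
    ∃ R : ℝ → MoebiusSpace ρ₀, (∀ ζ, logDeriv ρ (R 0).1 ζ = 0) ∧
      (∀ t, 0 ≤ t → logDeriv ρ (R t).1 ξ = t) ∧
      ∀ s t, 0 ≤ s → 0 ≤ t → ∀ ζ,
        |logDeriv ρ (R s).1 ζ - logDeriv ρ (R t).1 ζ| ≤ |s - t| := by
  obtain ⟨p, h0, hξ, hlip, hl, hconj⟩ := exists_extremal_ray (isKernel_log_sq h.1) ξ
  let τ : ℝ → C(Z, ℝ) := fun t =>
    ⟨fun x => -p |t| x, (continuous_of_conjugate_eq h.1 (hl |t| (abs_nonneg t))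
      (hconj |t| (abs_nonneg t))).neg⟩
  have hmem : ∀ t, eMap ρ (τ t) ∈ MoebiusSpace ρ₀ := fun t =>
    ⟨isAntipodal_eMap h.1 (τ t) (M := |t|) (by simpa [τ] using hl |t| (abs_nonneg t))
      (by simpa [τ] using hconj |t| (abs_nonneg t)),
      fun a b c d n1 n2 n3 n4 n5 n6 =>
        (h.2 a b c d n1 n2 n3 n4 n5 n6).trans (crossRatio_eMap (τ t) a b c d).symm⟩
  have hlog : ∀ t, 0 ≤ t → ∀ ζ, logDeriv ρ (eMap ρ (τ t)) ζ = -p t ζ := fun t ht ζ => by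
    rw [logDeriv, (isMDeriv_eMap (τ t)).mDeriv_eq h4 h.1.toIsSeparating, Real.log_exp]
    simp [τ, abs_of_nonneg ht]
  refine ⟨fun t => ⟨eMap ρ (τ t), hmem t⟩, fun ζ => ?_, fun t ht => ?_, fun s t hs ht ζ => ?_⟩
  · simp only
    rw [hlog 0 le_rfl, h0]
    simp
  · simp only
    rw [hlog t ht, hξ t ht, neg_neg]
  · simp only
    rw [hlog s hs, hlog t ht, abs_le]
    have h1 := hlip s t hs ht ζ
    have h2 := hlip t s ht hs ζ
    rw [abs_sub_comm t s] at h2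
    constructor <;> linarith

end Ray

theorem abs_sub_le_of_three_pieces {f : ℝ → ℝ} {a b : ℝ} (hab : a ≤ b)
    (h₁ : ∀ s t, s ≤ a → t ≤ a → |f s - f t| ≤ |s - t|)
    (h₂ : ∀ s ∈ Set.Icc a b, ∀ t ∈ Set.Icc a b, |f s - f t| ≤ |s - t|)
    (h₃ : ∀ s t, b ≤ s → b ≤ t → |f s - f t| ≤ |s - t|) (s t : ℝ) :
    |f s - f t| ≤ |s - t| := by
  wlog hst : s ≤ t generalizing s t
  · rw [abs_sub_comm, abs_sub_comm s]
    exact this t s (le_of_not_ge hst)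
  have glue : ∀ {s r t}, s ≤ r → r ≤ t → |f s - f r| ≤ |s - r| → |f r - f t| ≤ |r - t| →
      |f s - f t| ≤ |s - t| := fun {s r t} h h' e e' => by
    have := abs_sub_le (f s) (f r) (f t)
    rw [abs_of_nonpos (sub_nonpos.2 h)] at e
    rw [abs_of_nonpos (sub_nonpos.2 h')] at e'
    rw [abs_of_nonpos (sub_nonpos.2 (h.trans h'))]
    linarith
  have hleft : ∀ s t, s ≤ t → t ≤ b → |f s - f t| ≤ |s - t| := by
    intro s t hst htb
    rcases le_total t a with ht | ht
    · exact h₁ s t (hst.trans ht) ht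
    rcases le_total s a with hs | hs
    · exact glue hs ht (h₁ s a hs le_rfl) (h₂ a ⟨le_rfl, hab⟩ t ⟨ht, htb⟩)
    · exact h₂ s ⟨hs, hst.trans htb⟩ t ⟨ht, htb⟩
  rcases le_total t b with ht | ht
  · exact hleft s t hst ht
  rcases le_total s b with hs | hs
  · exact glue hs ht (hleft s b hs le_rfl) (h₃ b t le_rfl ht)
  · exact h₃ s t hs ht

end MoebiusGeodesic

open MoebiusGeodesic

theorem statement16 [TopologicalSpace Z] [CompactSpace Z]
    [TopologicalSpace.MetrizableSpace Z] (h4 : HasFourPoints Z)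
    (ρ₀ : Z → Z → ℝ) (h₀ : IsAntipodal ρ₀)
    (a b : ℝ) (hab : a ≤ b) (γ₀ : ℝ → MoebiusSpace ρ₀)
    (hγ₀ : ∀ s ∈ Set.Icc a b, ∀ t ∈ Set.Icc a b, dM (γ₀ s).1 (γ₀ t).1 = |s - t|)
    (ξ₀ η₀ : Z)
    (hξ₀ : ∀ ζ : Z, mDeriv (γ₀ a).1 (γ₀ b).1 ζ ≤ mDeriv (γ₀ a).1 (γ₀ b).1 ξ₀)
    (hη₀ : (γ₀ a).1 ξ₀ η₀ = 1) :
    ∃ κ : ℝ → MoebiusSpace ρ₀,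
      (∀ t ∈ Set.Icc a b, κ t = γ₀ t) ∧
      (∀ s t : ℝ, dM (κ s).1 (κ t).1 = |s - t|) ∧
      (∀ t : ℝ, a < t →
        ∀ ζ : Z, mDeriv (γ₀ a).1 (κ t).1 ζ ≤ mDeriv (γ₀ a).1 (κ t).1 ξ₀) ∧
      (∀ t : ℝ, t < a →
        ∀ ζ : Z, mDeriv (γ₀ a).1 (κ t).1 ζ ≤ mDeriv (γ₀ a).1 (κ t).1 η₀) := by
  have hmem : ∀ t, (γ₀ t).1 ∈ MoebiusSpace ρ₀ := fun t => (γ₀ t).2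
  have chain : ∀ x y z : MoebiusSpace ρ₀, ∀ ζ,
      logDeriv x.1 y.1 ζ + logDeriv y.1 z.1 ζ = logDeriv x.1 z.1 ζ := fun x y z ζ =>
    logDeriv_add_logDeriv h4 x.2 y.2 z.2 ζ
  have hself : ∀ x : MoebiusSpace ρ₀, ∀ ζ, logDeriv x.1 x.1 ζ = 0 := fun x ζ => by
    linarith [chain x x x ζ]
  obtain ⟨R, hR0, hRξ, hRlip⟩ := exists_ray h4 (hmem b) ξ₀
  obtain ⟨S, hS0, hSη, hSlip⟩ := exists_ray h4 (hmem a) η₀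
  let κ : ℝ → MoebiusSpace ρ₀ := fun t =>
    if t < a then S (a - t) else if t ≤ b then γ₀ t else R (t - b)
  let L : ℝ → Z → ℝ := fun t ζ => logDeriv (γ₀ a).1 (κ t).1 ζ
  have hL_left : ∀ t, t ≤ a → ∀ ζ, L t ζ = logDeriv (γ₀ a).1 (S (a - t)).1 ζ := by
    intro t ht ζ
    rcases ht.lt_or_eq with ht | rfl
    · simp [L, κ, ht]
    · simp [L, κ, hab, hS0, hself]
  have hL_mid : ∀ t ∈ Set.Icc a b, κ t = γ₀ t := fun t ht => by
    simp [κ, ht.1.not_gt, ht.2]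
  have hL_right : ∀ t, b ≤ t → ∀ ζ,
      L t ζ = logDeriv (γ₀ a).1 (γ₀ b).1 ζ + logDeriv (γ₀ b).1 (R (t - b)).1 ζ := by
    intro t ht ζ
    rcases ht.lt_or_eq with ht | rfl
    · simp [L, κ, (hab.trans_lt ht).not_gt, ht.not_ge, chain]
    · simp [L, κ, hab.not_gt, hR0]
  have hlogκ : ∀ s t ζ, logDeriv (κ s).1 (κ t).1 ζ = L t ζ - L s ζ := fun s t ζ => by
    linarith [chain (γ₀ a) (κ s) (κ t) ζ]
  have hlip : ∀ ζ s t, |L s ζ - L t ζ| ≤ |s - t| := fun ζ =>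
    abs_sub_le_of_three_pieces hab
      (fun s t hs ht => by
        rw [hL_left s hs, hL_left t ht]
        have := hSlip (a - s) (a - t) (by linarith) (by linarith) ζ
        rwa [sub_sub_sub_cancel_left, abs_sub_comm t s] at this)
      (fun s hs t ht => by
        have := abs_logDeriv_le_dM h4 (hmem s) (hmem t) ζ
        rw [hγ₀ s hs t ht, ← hL_mid s hs, ← hL_mid t ht, hlogκ] at this
        rwa [abs_sub_comm])
      (fun s t hs ht => by
        rw [hL_right s hs, hL_right t ht, add_sub_add_left_eq_sub]
        have := hRlip (s - b) (t - b) (by linarith) (by linarith) ζ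
        rwa [sub_sub_sub_cancel_right] at this)
  have hLa : ∀ ζ, L a ζ = 0 := fun ζ => by
    rw [hL_left a le_rfl, sub_self, hS0]
  have hLη : ∀ t, t ≤ a → L t η₀ = a - t := fun t ht => by
    rw [hL_left t ht, hSη _ (by linarith)]
  have hLξ_end : b - a ≤ L b ξ₀ := by
    have := dM_le_logDeriv_of_mDeriv_le h4 (hmem a) (hmem b) hξ₀
    rw [hγ₀ a ⟨le_rfl, hab⟩ b ⟨hab, le_rfl⟩, abs_sub_comm, abs_of_nonneg (by linarith)] at this
    rwa [hL_right b le_rfl, sub_self, hR0, add_zero]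
  have hLξ : ∀ t, L t ξ₀ = t - a := by
    intro t
    rcases le_total t a with ht | ht
    · have h1 := hlip ξ₀ t a
      rw [hLa, sub_zero, abs_of_nonpos (sub_nonpos.2 ht)] at h1
      have h2 : L t ξ₀ + L t η₀ ≤ 0 :=
        logDeriv_add_logDeriv_nonpos h4 (hmem a) (κ t).2 hη₀
      rw [hLη t ht] at h2
      linarith [(abs_le.1 h1).1]
    · have h1 := hlip ξ₀ t a
      rw [hLa, sub_zero, abs_of_nonneg (sub_nonneg.2 ht)] at h1
      rcases le_total t b with htb | htb
      · have h2 := hlip ξ₀ b t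
        rw [abs_of_nonneg (sub_nonneg.2 htb)] at h2
        linarith [(abs_le.1 h1).2, (abs_le.1 h2).2]
      · have h2 : L t ξ₀ = L b ξ₀ + (t - b) := by
          rw [hL_right t htb, hL_right b le_rfl, hRξ _ (sub_nonneg.2 htb), sub_self, hR0]
          ring
        linarith [(abs_le.1 h1).2]
  have hdist : ∀ s t, dM (κ s).1 (κ t).1 = |s - t| := by
    intro s t
    have : Nonempty Z := ⟨ξ₀⟩
    refine le_antisymm (ciSup_le fun ζ => ?_) ?_
    · change |logDeriv (κ s).1 (κ t).1 ζ| ≤ |s - t|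
      rw [hlogκ, abs_sub_comm]
      exact hlip ζ s t
    · have := abs_logDeriv_le_dM h4 (κ s).2 (κ t).2 ξ₀
      rwa [hlogκ, hLξ, hLξ, sub_sub_sub_cancel_right, abs_sub_comm] at this
  have hκa : κ a = γ₀ a := hL_mid a ⟨le_rfl, hab⟩
  refine ⟨κ, hL_mid, hdist, fun t ht => mDeriv_le_of_dM_le h4 (hmem a) (κ t).2 ?_,
    fun t ht => mDeriv_le_of_dM_le h4 (hmem a) (κ t).2 ?_⟩
  · change _ ≤ L t ξ₀
    rw [← hκa, hdist, hLξ, abs_of_nonpos (by linarith)]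
    linarith
  · change _ ≤ L t η₀
    rw [← hκa, hdist, hLη t ht.le, abs_of_pos (by linarith)]
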